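/- arXiv:2212.02680 — 2 statements merged into one kernel-verified Lean document; each statement's English description precedes it below -/
import Mathlib

section
/- Let X be a compact metric space, P and Q weak*-compact subsets of Δ(X), ε ∈ (0,1), and R a weak*-closed convex subset of Δ(X). There exist probability measures P in the closed convex hull of P, Q in the closed convex hull of Q, and R ∈ R such that P = (1 − ε)Q + εR if, and only if, for every continuous function f : X → ℝ with f(x) ≥ 0 for all x ∈ X and ‖f‖_∞ = 1, one has min over P ∈ P of ∫_X f dP ≤ (1 − ε)·(max over Q ∈ Q of ∫_X f dQ) + ε·(max over R ∈ R of ∫_X f dR). -/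
open MeasureTheory
open scoped NNReal

noncomputable section

/-- Closed convex hull (weak* topology) of a set of probability measures, inside finite measures. -/
def cchull {X : Type*} [MeasurableSpace X] [TopologicalSpace X] [OpensMeasurableSpace X]
    (S : Set (ProbabilityMeasure X)) : Set (FiniteMeasure X) :=
  closure (convexHull ℝ≥0 (ProbabilityMeasure.toFiniteMeasure '' S))

section ConvexSeparation

variable {X : Type*} [TopologicalSpace X] [MeasurableSpace X]

lemma integral_finiteMeasure_smul (f : C(X, ℝ)) (c : ℝ≥0) (μ : FiniteMeasure X) :
    ∫ x, f x ∂((c • μ : FiniteMeasure X) : Measure X) = c * ∫ x, f x ∂(μ : Measure X) := by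
  rw [FiniteMeasure.toMeasure_smul, integral_smul_nnreal_measure]
  rfl

/-- The algebraic dual of `C(X, ℝ)` with the topology of pointwise convergence. -/
abbrev WeakAlgDual (X : Type*) [TopologicalSpace X] : Type _ :=
  WeakBilin (LinearMap.id : Module.Dual ℝ C(X, ℝ) →ₗ[ℝ] C(X, ℝ) →ₗ[ℝ] ℝ)

variable [OpensMeasurableSpace X]

lemma cchull_subset {S : Set (ProbabilityMeasure X)} {T : Set (FiniteMeasure X)}
    (hT : IsClosed T) (hTc : Convex ℝ≥0 T) (h : ∀ P ∈ S, P.toFiniteMeasure ∈ T) :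
    cchull S ⊆ T :=
  closure_minimal (convexHull_min (Set.image_subset_iff.2 h) hTc) hT

lemma mem_cchull {S : Set (ProbabilityMeasure X)} {P : ProbabilityMeasure X} (hP : P ∈ S) :
    P.toFiniteMeasure ∈ cchull S :=
  subset_closure (subset_convexHull _ _ ⟨P, hP, rfl⟩)

lemma convex_cchull (S : Set (ProbabilityMeasure X)) : Convex ℝ≥0 (cchull S) := by
  intro μ hμ ν hν a b ha hb hab
  exact map_mem_closure₂ (f := fun μ ν : FiniteMeasure X => a • μ + b • ν) (by fun_prop) hμ hν
    fun μ hμ ν hν => convex_convexHull ℝ≥0 _ hμ hν ha hb hab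

lemma mass_eq_one_of_mem_cchull {S : Set (ProbabilityMeasure X)} {μ : FiniteMeasure X}
    (hμ : μ ∈ cchull S) : μ.mass = 1 := by
  refine cchull_subset (T := {μ | μ.mass = 1})
    (isClosed_eq FiniteMeasure.continuous_mass continuous_const) ?_
    (fun P _ => P.mass_toFiniteMeasure) hμ
  intro μ hμ ν hν a b _ _ hab
  simp_all [FiniteMeasure.mass]

variable [CompactSpace X]

lemma integrable_continuousMap_finiteMeasure (f : C(X, ℝ)) (μ : FiniteMeasure X) :
    Integrable f (μ : Measure X) :=
  (BoundedContinuousFunction.mkOfCompact f).integrable _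

lemma integral_finiteMeasure_add (f : C(X, ℝ)) (μ ν : FiniteMeasure X) :
    ∫ x, f x ∂((μ + ν : FiniteMeasure X) : Measure X) =
      ∫ x, f x ∂(μ : Measure X) + ∫ x, f x ∂(ν : Measure X) := by
  rw [FiniteMeasure.toMeasure_add]
  exact integral_add_measure (integrable_continuousMap_finiteMeasure f μ)
    (integrable_continuousMap_finiteMeasure f ν)

/-- Integration against a finite measure, as a linear map into the dual of `C(X, ℝ)`. -/
def integralFunctional : FiniteMeasure X →ₗ[ℝ≥0] WeakAlgDual X where
  toFun μ :=
    { toFun := fun f => ∫ x, f x ∂(μ : Measure X)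
      map_add' := fun f g => integral_add (integrable_continuousMap_finiteMeasure f μ)
        (integrable_continuousMap_finiteMeasure g μ)
      map_smul' := fun c f => integral_const_mul c f }
  map_add' μ ν := LinearMap.ext fun f => integral_finiteMeasure_add f μ ν
  map_smul' c μ := LinearMap.ext fun f => integral_finiteMeasure_smul f c μ

lemma continuous_integralFunctional :
    Continuous (integralFunctional : FiniteMeasure X → WeakAlgDual X) :=
  WeakBilin.continuous_of_continuous_eval _ fun f =>
    FiniteMeasure.continuous_integral_continuousMap f

lemma integralFunctional_injective [HasOuterApproxClosed X] [BorelSpace X] :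
    Function.Injective (integralFunctional : FiniteMeasure X → WeakAlgDual X) := by
  intro μ ν h
  refine Subtype.ext ?_
  change (μ : Measure X) = (ν : Measure X)
  exact ext_of_forall_integral_eq_of_IsFiniteMeasure fun f =>
    LinearMap.congr_fun h f.toContinuousMap

instance : T2Space (WeakAlgDual X) :=
  (WeakBilin.isEmbedding (B := (LinearMap.id : Module.Dual ℝ C(X, ℝ) →ₗ[ℝ] C(X, ℝ) →ₗ[ℝ] ℝ))
    Function.injective_id).t2Space

lemma Convex.integralFunctional_image {S : Set (FiniteMeasure X)} (hS : Convex ℝ≥0 S) :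
    Convex ℝ (integralFunctional '' S : Set (WeakAlgDual X)) := by
  rintro _ ⟨μ, hμ, rfl⟩ _ ⟨ν, hν, rfl⟩ a b ha hb hab
  lift a to ℝ≥0 using ha
  lift b to ℝ≥0 using hb
  refine ⟨a • μ + b • ν, hS hμ hν zero_le zero_le (by exact_mod_cast hab), ?_⟩
  rw [map_add, map_smul, map_smul]
  rfl

/-- Disjoint compact convex sets of finite measures are strictly separated by the integral of a
continuous function. -/
lemma exists_integral_lt_of_disjoint [HasOuterApproxClosed X] [BorelSpace X]
    {S T : Set (FiniteMeasure X)} (hS : IsCompact S) (hT : IsCompact T)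
    (hSc : Convex ℝ≥0 S) (hTc : Convex ℝ≥0 T) (hST : Disjoint S T) :
    ∃ g : C(X, ℝ), ∀ μ ∈ S, ∀ ν ∈ T, ∫ x, g x ∂(μ : Measure X) < ∫ x, g x ∂(ν : Measure X) := by
  obtain ⟨φ, u, v, hu, huv, hv⟩ := geometric_hahn_banach_compact_closed
    hSc.integralFunctional_image (hS.image continuous_integralFunctional)
    hTc.integralFunctional_image (hT.image continuous_integralFunctional).isClosed
    ((Set.disjoint_image_iff integralFunctional_injective).2 hST)
  obtain ⟨g, rfl⟩ := LinearMap.dualEmbedding_surjective _ φ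
  exact ⟨g, fun μ hμ ν hν => (hu _ ⟨μ, hμ, rfl⟩).trans (huv.trans (hv _ ⟨ν, hν, rfl⟩))⟩

lemma isCompact_of_isClosed_of_forall_mass_eq_one {X : Type*} [MetricSpace X] [CompactSpace X]
    [MeasurableSpace X] [BorelSpace X] {S : Set (FiniteMeasure X)} (hS : IsClosed S)
    (h : ∀ μ ∈ S, μ.mass = 1) : IsCompact S := by
  refine (isCompact_range (ProbabilityMeasure.toFiniteMeasure_continuous (Ω := X))).of_isClosed_subset
    hS fun μ hμ => ?_
  rw [ProbabilityMeasure.range_toFiniteMeasure]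
  exact h μ hμ

lemma convex_setOf_le_integral (f : C(X, ℝ)) (c : ℝ) :
    Convex ℝ≥0 {μ : FiniteMeasure X | c ≤ ∫ x, f x ∂(μ : Measure X)} := by
  intro μ hμ ν hν a b _ _ hab
  simp only [Set.mem_ofPred_eq, integral_finiteMeasure_add, integral_finiteMeasure_smul] at *
  have hab : (a : ℝ) + b = 1 := by exact_mod_cast hab
  calc c = a * c + b * c := by rw [← add_mul, hab, one_mul]
    _ ≤ _ := by gcongr

lemma le_integral_of_mem_cchull {S : Set (ProbabilityMeasure X)} (f : C(X, ℝ)) {c : ℝ}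
    (h : ∀ P ∈ S, c ≤ ∫ x, f x ∂(P : Measure X)) {μ : FiniteMeasure X} (hμ : μ ∈ cchull S) :
    c ≤ ∫ x, f x ∂(μ : Measure X) :=
  cchull_subset (isClosed_le continuous_const (FiniteMeasure.continuous_integral_continuousMap f))
    (convex_setOf_le_integral f c) h hμ

lemma integral_le_of_mem_cchull {S : Set (ProbabilityMeasure X)} (f : C(X, ℝ)) {c : ℝ}
    (h : ∀ P ∈ S, ∫ x, f x ∂(P : Measure X) ≤ c) {μ : FiniteMeasure X} (hμ : μ ∈ cchull S) :
    ∫ x, f x ∂(μ : Measure X) ≤ c := by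
  have := le_integral_of_mem_cchull (-f) (c := -c)
    (fun P hP => by simpa [integral_neg] using h P hP) hμ
  simpa [integral_neg] using this

lemma isCompact_cchull {X : Type*} [MetricSpace X] [CompactSpace X] [MeasurableSpace X]
    [BorelSpace X] (S : Set (ProbabilityMeasure X)) : IsCompact (cchull S) :=
  isCompact_of_isClosed_of_forall_mass_eq_one isClosed_closure
    fun _ => mass_eq_one_of_mem_cchull

/-- Normalizing a continuous function `g` to a nonnegative function of norm one, so that
integrals against probability measures are changed by an increasing affine map. -/
lemma exists_normalization (g : C(X, ℝ)) {P₀ P₁ : ProbabilityMeasure X}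
    (hne : ∫ x, g x ∂(P₀ : Measure X) ≠ ∫ x, g x ∂(P₁ : Measure X)) :
    ∃ f : C(X, ℝ), (∀ x, 0 ≤ f x) ∧ ‖f‖ = 1 ∧ ∃ a > 0, ∃ b : ℝ, ∀ P : ProbabilityMeasure X,
      ∫ x, f x ∂(P : Measure X) = a * (∫ x, g x ∂(P : Measure X) - b) := by
  obtain ⟨x₀⟩ := P₀.nonempty
  obtain ⟨x, -, hx⟩ := isCompact_univ.exists_isMinOn ⟨x₀, Set.mem_univ _⟩ g.continuous.continuousOn
  set h : C(X, ℝ) := g - ContinuousMap.const X (g x) with hh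
  have hint (P : ProbabilityMeasure X) :
      ∫ y, h y ∂(P : Measure X) = ∫ y, g y ∂(P : Measure X) - g x := by
    have := integral_sub (integrable_continuousMap_finiteMeasure g P.toFiniteMeasure)
      (integrable_const (g x))
    simpa [hh] using this
  have h0 : h ≠ 0 := by
    intro h0
    have h₀ := hint P₀
    have h₁ := hint P₁
    simp only [h0, ContinuousMap.zero_apply, integral_zero] at h₀ h₁
    exact hne (by linarith)
  have hpos : 0 < ‖h‖ := norm_pos_iff.2 h0
  refine ⟨‖h‖⁻¹ • h, fun y => ?_, ?_, ‖h‖⁻¹, inv_pos.2 hpos, g x, fun P => ?_⟩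
  · exact mul_nonneg (inv_nonneg.2 hpos.le) (sub_nonneg.2 (hx (Set.mem_univ y)))
  · rw [norm_smul, norm_inv, norm_norm, inv_mul_cancel₀ hpos.ne']
  · rw [← hint P]
    exact integral_const_mul _ _

end ConvexSeparation

theorem stmt5 {X : Type*} [MetricSpace X] [CompactSpace X] [MeasurableSpace X] [BorelSpace X]
    (𝒮 𝒬 : Set (ProbabilityMeasure X)) (h𝒮 : IsCompact 𝒮) (h𝒬 : IsCompact 𝒬)
    (h𝒮ne : 𝒮.Nonempty) (h𝒬ne : 𝒬.Nonempty)
    (ℛ : Set (ProbabilityMeasure X)) (hℛne : ℛ.Nonempty)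
    (hℛclosed : IsClosed (ProbabilityMeasure.toFiniteMeasure '' ℛ))
    (hℛconvex : Convex ℝ≥0 (ProbabilityMeasure.toFiniteMeasure '' ℛ))
    (ε : ℝ≥0) (hε0 : 0 < ε) (hε1 : ε < 1) :
    (∃ P ∈ cchull 𝒮, ∃ Q ∈ cchull 𝒬, ∃ R ∈ ℛ,
        P = (1 - ε) • Q + ε • R.toFiniteMeasure) ↔
      ∀ f : C(X, ℝ), (∀ x, 0 ≤ f x) → ‖f‖ = 1 →
        sInf ((fun P : ProbabilityMeasure X => ∫ x, f x ∂(P : Measure X)) '' 𝒮) ≤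
          (1 - (ε : ℝ)) * sSup ((fun Q : ProbabilityMeasure X => ∫ x, f x ∂(Q : Measure X)) '' 𝒬)
            + (ε : ℝ) * sSup ((fun R : ProbabilityMeasure X => ∫ x, f x ∂(R : Measure X)) '' ℛ) := by
  have hcont (f : C(X, ℝ)) :
      Continuous fun P : ProbabilityMeasure X => ∫ x, f x ∂(P : Measure X) :=
    ProbabilityMeasure.continuous_integral_continuousMap f
  have hℛ' : IsCompact (ProbabilityMeasure.toFiniteMeasure '' ℛ) :=
    isCompact_of_isClosed_of_forall_mass_eq_one hℛclosed
      (by rintro _ ⟨R, -, rfl⟩; exact R.mass_toFiniteMeasure)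
  have hℛ : IsCompact ℛ := (ProbabilityMeasure.toFiniteMeasure_isEmbedding X).isCompact_iff.2 hℛ'
  have hε : ((1 - ε : ℝ≥0) : ℝ) = 1 - (ε : ℝ) := NNReal.coe_sub hε1.le
  have hcomb (f : C(X, ℝ)) (Q R : FiniteMeasure X) :
      ∫ x, f x ∂(((1 - ε) • Q + ε • R : FiniteMeasure X) : Measure X) =
        (1 - (ε : ℝ)) * ∫ x, f x ∂(Q : Measure X) + ε * ∫ x, f x ∂(R : Measure X) := by
    rw [integral_finiteMeasure_add, integral_finiteMeasure_smul, integral_finiteMeasure_smul, hε]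
  have hε' : (0 : ℝ) ≤ 1 - (ε : ℝ) := hε ▸ NNReal.coe_nonneg _
  constructor
  · rintro ⟨P, hP, Q, hQ, R, hR, hPQR⟩ f - -
    have hPle := le_integral_of_mem_cchull f
      (fun P hP => csInf_le (h𝒮.image (hcont f)).bddBelow ⟨P, hP, rfl⟩) hP
    have hQle := integral_le_of_mem_cchull f
      (fun Q hQ => le_csSup (h𝒬.image (hcont f)).bddAbove ⟨Q, hQ, rfl⟩) hQ
    have hRle := le_csSup (hℛ.image (hcont f)).bddAbove ⟨R, hR, rfl⟩
    refine hPle.trans ?_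
    rw [hPQR, hcomb]
    gcongr
    exact hRle
  · intro H
    by_contra hno
    set T : Set (FiniteMeasure X) :=
      (fun p : FiniteMeasure X × FiniteMeasure X => (1 - ε) • p.1 + ε • p.2) ''
        (cchull 𝒬 ×ˢ (ProbabilityMeasure.toFiniteMeasure '' ℛ)) with hT
    have hTcompact : IsCompact T := ((isCompact_cchull 𝒬).prod hℛ').image (by fun_prop)
    have hTconvex : Convex ℝ≥0 T := by
      have := (convex_cchull 𝒬).prod hℛconvex
      exact this.linear_image
        ((1 - ε) • LinearMap.fst ℝ≥0 (FiniteMeasure X) (FiniteMeasure X) +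
          ε • LinearMap.snd ℝ≥0 (FiniteMeasure X) (FiniteMeasure X))
    have hdisj : Disjoint T (cchull 𝒮) := by
      rw [Set.disjoint_left]
      rintro _ ⟨⟨Q, _⟩, ⟨hQ, R, hR, rfl⟩, rfl⟩ hP
      exact hno ⟨_, hP, Q, hQ, R, hR, rfl⟩
    obtain ⟨g, hg⟩ := exists_integral_lt_of_disjoint hTcompact (isCompact_cchull 𝒮)
      hTconvex (convex_cchull 𝒮) hdisj
    have hg' : ∀ P ∈ 𝒮, ∀ Q ∈ 𝒬, ∀ R ∈ ℛ,
        (1 - (ε : ℝ)) * ∫ x, g x ∂(Q : Measure X) + ε * ∫ x, g x ∂(R : Measure X) <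
          ∫ x, g x ∂(P : Measure X) := fun P hP Q hQ R hR => by
      have := hg _ ⟨(Q.toFiniteMeasure, R.toFiniteMeasure), ⟨mem_cchull hQ, R, hR, rfl⟩, rfl⟩ _
        (mem_cchull hP)
      rwa [hcomb] at this
    obtain ⟨f, hf0, hf1, a, ha, b, hab⟩ : ∃ f : C(X, ℝ), (∀ x, 0 ≤ f x) ∧ ‖f‖ = 1 ∧
        ∃ a > 0, ∃ b : ℝ, ∀ P : ProbabilityMeasure X,
          ∫ x, f x ∂(P : Measure X) = a * (∫ x, g x ∂(P : Measure X) - b) := by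
      obtain ⟨P, hP⟩ := h𝒮ne
      obtain ⟨Q, hQ⟩ := h𝒬ne
      obtain ⟨R, hR⟩ := hℛne
      have hlt := hg' P hP Q hQ R hR
      by_cases hPQ : ∫ x, g x ∂(P : Measure X) = ∫ x, g x ∂(Q : Measure X)
      · refine exists_normalization g (P₀ := P) (P₁ := R) fun hPR => ?_
        rw [← hPQ, ← hPR] at hlt
        linarith
      · exact exists_normalization g hPQ
    obtain ⟨P, hP, hPeq⟩ := h𝒮.exists_sInf_image_eq h𝒮ne (hcont f).continuousOn
    obtain ⟨Q, hQ, hQeq⟩ := h𝒬.exists_sSup_image_eq h𝒬ne (hcont f).continuousOn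
    obtain ⟨R, hR, hReq⟩ := hℛ.exists_sSup_image_eq hℛne (hcont f).continuousOn
    have hle := H f hf0 hf1
    rw [hPeq, hQeq, hReq, hab, hab, hab] at hle
    have := mul_lt_mul_of_pos_left (hg' P hP Q hQ R hR) ha
    linarith

end
end

section
/- Let X be a compact metric space, P a Borel probability measure on X, Q a nonempty weak*-compact subset of Δ(X), and ε > 0. There exist a Borel signed measure e on X with ‖e‖₁ ≤ ε and a Borel probability measure m on Q such that P = Q_m + e if, and only if, P and Q satisfy condition C_ε: for all continuous f, g : X → ℝ, if ∫_X f dQ ≥ ∫_X g dQ for all Q ∈ Q, then ∫_X f dP ≥ ∫_X g dP − ε·ω(f − g)/2, where ω(h) = sup over x₁, x₂ ∈ X of (h(x₁) − h(x₂)) is the oscillation of h. -/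
open MeasureTheory
open scoped NNReal

noncomputable section

noncomputable instance {X : Type*} [MeasurableSpace X] [TopologicalSpace X] [OpensMeasurableSpace X] :
    MeasurableSpace (ProbabilityMeasure X) := borel _

/-- Total variation norm of a signed measure. -/
def tvNorm {X : Type*} [MeasurableSpace X] (e : SignedMeasure X) : ℝ :=
  (e.totalVariation Set.univ).toReal

/-- Oscillation of a continuous function: `ω(h) = sup_{x₁,x₂} (h x₁ - h x₂)`. -/
def osc {X : Type*} [TopologicalSpace X] (h : C(X, ℝ)) : ℝ :=
  ⨆ p : X × X, (h p.1 - h p.2)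

/-- `Qm` is the barycenter of `m : Δ(𝒬)`: `Qm E = ∫_𝒬 Q(E) dm(Q)` for every Borel `E`. -/
def IsBarycenter {X : Type*} [MeasurableSpace X] [TopologicalSpace X] [OpensMeasurableSpace X]
    (𝒬 : Set (ProbabilityMeasure X)) (m : Measure ↥𝒬) (Qm : ProbabilityMeasure X) : Prop :=
  ∀ E : Set X, MeasurableSet E →
    (Qm E : ℝ) = ∫ Q, ((Q : ProbabilityMeasure X) E : ℝ) ∂m

lemma osc_smul {K : Type*} [TopologicalSpace K] {c : ℝ} (hc : 0 ≤ c) (h : C(K, ℝ)) :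
    osc (c • h) = c * osc h := by
  simp only [osc, Real.mul_iSup_of_nonneg hc, ContinuousMap.smul_apply, smul_eq_mul, mul_sub]

section CompactSup

variable {K : Type*} [TopologicalSpace K] [CompactSpace K]

lemma bddAbove_range_of_continuous {φ : K → ℝ} (hφ : Continuous φ) : BddAbove (Set.range φ) :=
  (isCompact_range hφ).bddAbove

lemma iSup_add_le_of_continuous [Nonempty K] {φ ψ : K → ℝ} (hφ : Continuous φ)
    (hψ : Continuous ψ) : ⨆ k, (φ k + ψ k) ≤ (⨆ k, φ k) + ⨆ k, ψ k :=
  ciSup_le fun k => add_le_add (le_ciSup (bddAbove_range_of_continuous hφ) k)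
    (le_ciSup (bddAbove_range_of_continuous hψ) k)

lemma sub_le_osc (h : C(K, ℝ)) (x y : K) : h x - h y ≤ osc h :=
  le_ciSup (f := fun p : K × K => h p.1 - h p.2)
    (bddAbove_range_of_continuous (by fun_prop)) (x, y)

lemma osc_add_le [Nonempty K] (g h : C(K, ℝ)) : osc (g + h) ≤ osc g + osc h :=
  ciSup_le fun p => by
    have h₁ := sub_le_osc g p.1 p.2
    have h₂ := sub_le_osc h p.1 p.2
    simp only [ContinuousMap.add_apply]
    linarith

/-- A linear functional on `C(K, ℝ)` dominated by the supremum is integration against a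
probability measure. -/
lemma exists_isProbabilityMeasure_integral_eq [T2Space K] [MeasurableSpace K] [BorelSpace K]
    [Nonempty K] (L : C(K, ℝ) →ₗ[ℝ] ℝ) (hL : ∀ φ, L φ ≤ ⨆ k, φ k) :
    ∃ m : Measure K, IsProbabilityMeasure m ∧ ∀ φ : C(K, ℝ), ∫ k, φ k ∂m = L φ := by
  have hpos (φ : C(K, ℝ)) (hφ : ∀ k, 0 ≤ φ k) : 0 ≤ L φ := by
    have h := (hL (-φ)).trans (ciSup_le fun k => neg_nonpos.2 (hφ k))
    rw [map_neg] at h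
    linarith
  have hone : L 1 = 1 := by
    have h₁ := hL 1
    have h₂ := hL (-1)
    rw [map_neg] at h₂
    simp only [ContinuousMap.one_apply, ContinuousMap.neg_apply, ciSup_const] at h₁ h₂
    linarith
  let T : CompactlySupportedContinuousMap K ℝ →ₗ[ℝ] ℝ :=
    { toFun f := L f.toContinuousMap
      map_add' f g := L.map_add f.toContinuousMap g.toContinuousMap
      map_smul' c f := L.map_smul c f.toContinuousMap }
  let Λ : CompactlySupportedContinuousMap K ℝ →ₚ[ℝ] ℝ := .mk₀ T fun f hf => hpos _ hf
  have hΛ (φ : C(K, ℝ)) : ∫ k, φ k ∂(RealRMK.rieszMeasure Λ) = L φ :=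
    RealRMK.integral_rieszMeasure Λ ⟨φ, HasCompactSupport.of_compactSpace _⟩
  refine ⟨RealRMK.rieszMeasure Λ, ⟨?_⟩, hΛ⟩
  have h := hΛ 1
  rw [hone] at h
  simp only [ContinuousMap.one_apply, integral_const, smul_eq_mul, mul_one, measureReal_def] at h
  exact (ENNReal.toReal_eq_one_iff _).1 h

end CompactSup

section Measurability

variable {X : Type*} [TopologicalSpace X] [HasOuterApproxClosed X] [MeasurableSpace X]
  [BorelSpace X]

instance : BorelSpace (ProbabilityMeasure X) := ⟨rfl⟩

lemma measurable_probabilityMeasure_toMeasure :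
    Measurable fun Q : ProbabilityMeasure X => (Q : Measure X) := by
  refine Measurable.measure_of_isPiSystem_of_isProbabilityMeasure
    (BorelSpace.measurable_eq.trans borel_eq_generateFrom_isClosed) isPiSystem_isClosed
    fun F (hF : IsClosed F) => ?_
  refine measurable_of_tendsto_metrizable (f := fun n (Q : ProbabilityMeasure X) =>
    ∫⁻ x, hF.apprSeq n x ∂(Q : Measure X)) (fun n => Continuous.measurable ?_)
    (tendsto_pi_nhds.2 fun Q => HasOuterApproxClosed.tendsto_lintegral_apprSeq hF _)
  exact ProbabilityMeasure.continuous_lintegral_boundedContinuousFunction _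

/-- The inclusion of a set of probability measures as a Markov kernel. -/
def inclusionKernel (𝒬 : Set (ProbabilityMeasure X)) : ProbabilityTheory.Kernel 𝒬 X :=
  ⟨fun Q => ((Q : ProbabilityMeasure X) : Measure X),
    measurable_probabilityMeasure_toMeasure.comp measurable_subtype_coe⟩

instance (𝒬 : Set (ProbabilityMeasure X)) :
    ProbabilityTheory.IsMarkovKernel (inclusionKernel 𝒬) :=
  ⟨fun Q => inferInstanceAs (IsProbabilityMeasure ((Q : ProbabilityMeasure X) : Measure X))⟩

variable {𝒬 : Set (ProbabilityMeasure X)} {m : Measure 𝒬} {Qm : ProbabilityMeasure X}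

lemma isBarycenter_iff_eq_bind [IsFiniteMeasure m] :
    IsBarycenter 𝒬 m Qm ↔ (Qm : Measure X) = m.bind (inclusionKernel 𝒬) := by
  have key (E : Set X) (hE : MeasurableSet E) :
      ∫ Q, ((Q : ProbabilityMeasure X) E : ℝ) ∂m = (m.bind (inclusionKernel 𝒬)).real E := by
    rw [measureReal_def, Measure.bind_apply hE (inclusionKernel 𝒬).measurable.aemeasurable]
    exact integral_toReal ((inclusionKernel 𝒬).measurable_coe hE).aemeasurable
      (.of_forall fun Q => measure_lt_top _ _)
  constructor
  · intro h
    ext E hE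
    exact (measureReal_eq_measureReal_iff).1 ((h E hE).trans (key E hE))
  · intro h E hE
    rw [key E hE, ← h]
    rfl

lemma IsBarycenter.integral_eq [IsFiniteMeasure m] (h : IsBarycenter 𝒬 m Qm) {f : X → ℝ}
    (hf : Integrable f Qm) :
    ∫ x, f x ∂(Qm : Measure X) =
      ∫ Q, ∫ x, f x ∂((Q : ProbabilityMeasure X) : Measure X) ∂m := by
  have h' : (Qm : Measure X) =
      ((inclusionKernel 𝒬).comp (ProbabilityTheory.Kernel.const Unit m)) () := by
    rw [ProbabilityTheory.Kernel.comp_apply, isBarycenter_iff_eq_bind.1 h]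
    rfl
  rw [h'] at hf ⊢
  exact ProbabilityTheory.Kernel.integral_comp hf

lemma exists_isBarycenter [IsProbabilityMeasure m] : ∃ Qm, IsBarycenter 𝒬 m Qm :=
  ⟨⟨m.bind (inclusionKernel 𝒬), inferInstance⟩, isBarycenter_iff_eq_bind.2 rfl⟩

end Measurability

section TotalVariation

variable {X : Type*} [MeasurableSpace X]

/-- For a signed measure of total mass zero, both Jordan parts carry half of the total variation. -/
lemma tvNorm_eq_two_mul_posPart {e : SignedMeasure X} (he : e Set.univ = 0) :
    tvNorm e = 2 * e.toJordanDecomposition.posPart.real Set.univ ∧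
      e.toJordanDecomposition.negPart.real Set.univ =
        e.toJordanDecomposition.posPart.real Set.univ := by
  have h := e.apply_eq_posPart_real_sub_negPart_real MeasurableSet.univ
  have h' : tvNorm e = e.toJordanDecomposition.posPart.real Set.univ +
      e.toJordanDecomposition.negPart.real Set.univ := measureReal_add_apply
  constructor <;> linarith

lemma exists_tvNorm_eq_two_mul {e : SignedMeasure X} (he : e Set.univ = 0) :
    ∃ i, MeasurableSet i ∧ tvNorm e = 2 * e i := by
  obtain ⟨i, hi, hpos, -, hp, -⟩ := e.toJordanDecomposition_spec
  refine ⟨i, hi, ?_⟩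
  rw [(tvNorm_eq_two_mul_posPart he).1, hp,
    SignedMeasure.toMeasureOfZeroLE_real_apply _ hpos hi MeasurableSet.univ, Set.inter_univ]

variable {P S : Measure X} [IsProbabilityMeasure P] [IsProbabilityMeasure S]

lemma toSignedMeasure_sub_univ : (P.toSignedMeasure - S.toSignedMeasure) Set.univ = 0 := by
  rw [Measure.toSignedMeasure_sub_apply MeasurableSet.univ]
  simp

variable [TopologicalSpace X] [BorelSpace X]

lemma tvNorm_sub_le_of_integral_sub_le [Nonempty X] [HasOuterApproxClosed X]
    [P.WeaklyRegular] {ε : ℝ} (hε : 0 ≤ ε)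
    (h : ∀ f : C(X, ℝ), ∫ x, f x ∂P - ∫ x, f x ∂S ≤ ε * osc f / 2) :
    tvNorm (P.toSignedMeasure - S.toSignedMeasure) ≤ ε := by
  have hclosed {F : Set X} (hF : IsClosed F) : P.real F ≤ S.real F + ε / 2 := by
    have hS := HasOuterApproxClosed.tendsto_lintegral_apprSeq hF S
    have hS' := ((ENNReal.tendsto_toReal (measure_ne_top S F)).comp hS).add_const (ε / 2)
    refine ge_of_tendsto' hS' fun n => ?_
    let f : C(X, ℝ) := ⟨fun x => hF.apprSeq n x, by fun_prop⟩
    have hint (ρ : Measure X) : ∫ x, f x ∂ρ = (∫⁻ x, hF.apprSeq n x ∂ρ).toReal := by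
      change ∫ x, (hF.apprSeq n x : ℝ) ∂ρ = _
      rw [integral_eq_lintegral_of_nonneg_ae (.of_forall fun x => NNReal.coe_nonneg _)
        f.continuous.measurable.aestronglyMeasurable]
      simp
    have hfin (ρ : Measure X) [IsFiniteMeasure ρ] : ∫⁻ x, hF.apprSeq n x ∂ρ ≠ ⊤ :=
      (BoundedContinuousFunction.lintegral_lt_top_of_nnreal ρ _).ne
    have hle := ENNReal.toReal_mono (hfin P) (HasOuterApproxClosed.measure_le_lintegral hF P n)
    have hosc : osc f ≤ 1 := ciSup_le fun p => by
      have h₁ : f p.1 ≤ 1 := HasOuterApproxClosed.apprSeq_apply_le_one hF n p.1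
      have h₂ : 0 ≤ f p.2 := NNReal.coe_nonneg _
      linarith
    have h₁ := h f
    have h₂ := mul_le_mul_of_nonneg_left hosc hε
    rw [hint, hint] at h₁
    simp only [Function.comp_apply, measureReal_def]
    linarith
  obtain ⟨i, hi, htv⟩ := exists_tvNorm_eq_two_mul (toSignedMeasure_sub_univ (P := P) (S := S))
  rw [htv, Measure.toSignedMeasure_sub_apply hi]
  suffices P.real i ≤ S.real i + ε / 2 by linarith
  refine le_of_forall_lt fun r hr => ?_
  rcases lt_or_ge r 0 with hr0 | hr0
  · exact hr0.trans_le (by positivity)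
  obtain ⟨F, hFi, hF, hrF⟩ := hi.exists_lt_isClosed_of_ne_top (measure_ne_top P i)
    ((ENNReal.ofReal_lt_iff_lt_toReal hr0 (measure_ne_top P i)).2 hr)
  calc r < P.real F := (ENNReal.ofReal_lt_iff_lt_toReal hr0 (measure_ne_top P F)).1 hrF
    _ ≤ S.real F + ε / 2 := hclosed hF
    _ ≤ S.real i + ε / 2 := by gcongr; exact measure_ne_top _ _

variable [CompactSpace X]

lemma integrable_continuousMap (h : C(X, ℝ)) (ρ : Measure X) [IsFiniteMeasure ρ] :
    Integrable h ρ :=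
  h.continuous.integrable_of_hasCompactSupport (HasCompactSupport.of_compactSpace _)

lemma integral_sub_le_tvNorm_mul_osc [Nonempty X] (h : C(X, ℝ)) :
    ∫ x, h x ∂P - ∫ x, h x ∂S ≤
      tvNorm (P.toSignedMeasure - S.toSignedMeasure) * osc h / 2 := by
  set e := P.toSignedMeasure - S.toSignedMeasure with he
  set μ := e.toJordanDecomposition.posPart
  set ν := e.toJordanDecomposition.negPart
  obtain ⟨h₁, h₂⟩ := tvNorm_eq_two_mul_posPart (toSignedMeasure_sub_univ (P := P) (S := S))
  have hmeas : P + ν = S + μ := by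
    ext s hs
    rw [← measureReal_eq_measureReal_iff, measureReal_add_apply, measureReal_add_apply]
    have h₃ := e.apply_eq_posPart_real_sub_negPart_real hs
    rw [he, Measure.toSignedMeasure_sub_apply hs] at h₃
    linarith
  have hsum : ∫ x, h x ∂P + ∫ x, h x ∂ν = ∫ x, h x ∂S + ∫ x, h x ∂μ := by
    rw [← integral_add_measure (integrable_continuousMap h _) (integrable_continuousMap h _), hmeas,
      integral_add_measure (integrable_continuousMap h _) (integrable_continuousMap h _)]
  obtain ⟨a, -, ha⟩ := isCompact_univ.exists_isMinOn Set.univ_nonempty h.continuous.continuousOn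
  obtain ⟨b, -, hb⟩ := isCompact_univ.exists_isMaxOn Set.univ_nonempty h.continuous.continuousOn
  have hν : h a * ν.real Set.univ ≤ ∫ x, h x ∂ν := by
    simpa [mul_comm] using integral_mono (integrable_const (h a)) (integrable_continuousMap h ν)
      fun x => ha (Set.mem_univ x)
  have hμ : ∫ x, h x ∂μ ≤ h b * μ.real Set.univ := by
    simpa [mul_comm] using integral_mono (integrable_continuousMap h μ) (integrable_const (h b))
      fun x => hb (Set.mem_univ x)
  have h₃ := mul_le_mul_of_nonneg_right (sub_le_osc h b a)
    (measureReal_nonneg (μ := μ) (s := Set.univ))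
  rw [h₁]
  rw [h₂] at hν
  linarith

end TotalVariation

section Separation

variable {X : Type*} [MetricSpace X] [CompactSpace X] [MeasurableSpace X] [BorelSpace X]

/-- Integration of a fixed continuous function, as a continuous function of the measure. -/
def integralMap (𝒬 : Set (ProbabilityMeasure X)) : C(X, ℝ) →ₗ[ℝ] C(𝒬, ℝ) where
  toFun h := ⟨fun Q => ∫ x, h x ∂((Q : ProbabilityMeasure X) : Measure X),
    (ProbabilityMeasure.continuous_integral_boundedContinuousFunction
      (BoundedContinuousFunction.mkOfCompact h)).comp continuous_subtype_val⟩
  map_add' g h := by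
    ext Q
    exact integral_add (integrable_continuousMap g _) (integrable_continuousMap h _)
  map_smul' c h := by
    ext Q
    exact integral_const_mul c _

/-- If `P` is almost nonnegative on the continuous functions on which all of `𝒬` is nonnegative,
then a mixture of the measures in `𝒬` approximates `P` up to half the oscillation. -/
lemma exists_mixture_integral_sub_le [Nonempty X] (P : ProbabilityMeasure X)
    {𝒬 : Set (ProbabilityMeasure X)} (h𝒬 : IsCompact 𝒬) (h𝒬ne : 𝒬.Nonempty) {ε : ℝ} (hε : 0 ≤ ε)
    (hP : ∀ h : C(X, ℝ), (∀ Q : 𝒬, 0 ≤ integralMap 𝒬 h Q) →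
      -(ε * osc h / 2) ≤ ∫ x, h x ∂(P : Measure X)) :
    ∃ m : Measure 𝒬, IsProbabilityMeasure m ∧
      ∀ h : C(X, ℝ), ∫ x, h x ∂(P : Measure X) - ∫ Q, integralMap 𝒬 h Q ∂m ≤ ε * osc h / 2 := by
  have : CompactSpace 𝒬 := isCompact_iff_compactSpace.1 h𝒬
  have : Nonempty 𝒬 := h𝒬ne.to_subtype
  let N : C(X, ℝ) × C(𝒬, ℝ) → ℝ := fun p => ε * osc p.1 / 2 + ⨆ Q, p.2 Q
  let I : C(X, ℝ) →ₗ[ℝ] ℝ :=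
    { toFun h := ∫ x, h x ∂(P : Measure X)
      map_add' g h := integral_add (integrable_continuousMap g _) (integrable_continuousMap h _)
      map_smul' c h := integral_const_mul c _ }
  let F : C(X, ℝ) × C(𝒬, ℝ) →ₗ.[ℝ] ℝ :=
    ⟨(integralMap 𝒬).graph, I ∘ₗ LinearMap.fst ℝ _ _ ∘ₗ (integralMap 𝒬).graph.subtype⟩
  obtain ⟨G, hGF, hGN⟩ := exists_extension_of_le_sublinear F N
    (fun c hc p => by
      simp only [N, Prod.smul_fst, Prod.smul_snd, osc_smul hc.le, ContinuousMap.smul_apply,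
        smul_eq_mul, ← Real.mul_iSup_of_nonneg hc.le]
      ring)
    (fun p q => by
      have h₁ := mul_le_mul_of_nonneg_left (osc_add_le p.1 q.1) hε
      have h₂ := iSup_add_le_of_continuous p.2.continuous q.2.continuous
      simp only [N, Prod.fst_add, Prod.snd_add, ContinuousMap.add_apply]
      linarith)
    (by
      rintro ⟨⟨h, φ⟩, hφ⟩
      obtain rfl : φ = integralMap 𝒬 h := hφ
      change ∫ x, h x ∂(P : Measure X) ≤ ε * osc h / 2 + ⨆ Q, integralMap 𝒬 h Q
      set s := ⨆ Q, integralMap 𝒬 h Q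
      have hint (ρ : ProbabilityMeasure X) :
          ∫ x, (ContinuousMap.const X s - h) x ∂(ρ : Measure X) =
            s - ∫ x, h x ∂(ρ : Measure X) := by
        simp only [ContinuousMap.sub_apply, ContinuousMap.const_apply]
        rw [integral_sub (integrable_const _) (integrable_continuousMap h _)]
        simp
      have hosc : osc (ContinuousMap.const X s - h) ≤ osc h := ciSup_le fun p => by
        have := sub_le_osc h p.2 p.1
        simp only [ContinuousMap.sub_apply, ContinuousMap.const_apply]
        linarith
      have h₁ := hP (ContinuousMap.const X s - h) fun Q => by
        change 0 ≤ ∫ x, (ContinuousMap.const X s - h) x ∂((Q : ProbabilityMeasure X) : Measure X)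
        rw [hint]
        exact sub_nonneg.2
          (le_ciSup (bddAbove_range_of_continuous (integralMap 𝒬 h).continuous) Q)
      rw [hint] at h₁
      have h₂ := mul_le_mul_of_nonneg_left hosc hε
      linarith)
  have hosc0 : osc (0 : C(X, ℝ)) = 0 := by simp [osc]
  obtain ⟨m, hm, hmG⟩ := exists_isProbabilityMeasure_integral_eq
    (G ∘ₗ LinearMap.inr ℝ C(X, ℝ) C(𝒬, ℝ)) fun φ => by
      have := hGN (0, φ)
      simpa [N, hosc0] using this
  refine ⟨m, hm, fun h => ?_⟩
  have h₁ : G (h, integralMap 𝒬 h) = ∫ x, h x ∂(P : Measure X) := hGF ⟨(h, integralMap 𝒬 h), rfl⟩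
  have h₂ := hGN (h, 0)
  have h₃ : G (h, integralMap 𝒬 h) = G (h, 0) + G (0, integralMap 𝒬 h) := by
    rw [← map_add]
    simp
  have h₄ := hmG (integralMap 𝒬 h)
  simp only [N, ContinuousMap.zero_apply, ciSup_const, add_zero, LinearMap.comp_apply,
    LinearMap.inr_apply] at h₂ h₄
  linarith

end Separation

theorem stmt7 {X : Type*} [MetricSpace X] [CompactSpace X] [MeasurableSpace X] [BorelSpace X]
    (P : ProbabilityMeasure X)
    (𝒬 : Set (ProbabilityMeasure X)) (h𝒬 : IsCompact 𝒬) (h𝒬ne : 𝒬.Nonempty)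
    (ε : ℝ) (hε : 0 < ε) :
    (∃ (e : SignedMeasure X) (m : Measure ↥𝒬) (_ : IsProbabilityMeasure m)
        (Qm : ProbabilityMeasure X), IsBarycenter 𝒬 m Qm ∧ tvNorm e ≤ ε ∧
          P.toMeasure.toSignedMeasure = Qm.toMeasure.toSignedMeasure + e) ↔
      (∀ f g : C(X, ℝ),
        (∀ Q ∈ 𝒬, ∫ x, g x ∂((Q : ProbabilityMeasure X) : Measure X) ≤
            ∫ x, f x ∂((Q : ProbabilityMeasure X) : Measure X)) →
          ∫ x, f x ∂(P : Measure X) ≥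
            ∫ x, g x ∂(P : Measure X) - ε * osc (f - g) / 2) := by
  have : Nonempty X := nonempty_of_isProbabilityMeasure (P : Measure X)
  have hsub (ρ : ProbabilityMeasure X) (f g : C(X, ℝ)) : ∫ x, (f - g) x ∂(ρ : Measure X) =
      ∫ x, f x ∂(ρ : Measure X) - ∫ x, g x ∂(ρ : Measure X) :=
    integral_sub (integrable_continuousMap f _) (integrable_continuousMap g _)
  constructor
  · rintro ⟨e, m, hm, Qm, hQm, he, hP⟩ f g hfg
    obtain rfl : P.toMeasure.toSignedMeasure - Qm.toMeasure.toSignedMeasure = e := by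
      rw [hP, add_sub_cancel_left]
    have hnn : 0 ≤ ∫ x, (f - g) x ∂(Qm : Measure X) := by
      rw [hQm.integral_eq (integrable_continuousMap (f - g) _)]
      refine integral_nonneg fun Q => ?_
      have := hfg Q Q.2
      simp only [Pi.zero_apply, hsub]
      linarith
    have h₁ := integral_sub_le_tvNorm_mul_osc (P := P) (S := Qm) (-(f - g))
    have hosc : osc (-(f - g)) ≤ osc (f - g) := ciSup_le fun p => by
      have := sub_le_osc (f - g) p.2 p.1
      simp only [ContinuousMap.neg_apply]
      linarith
    have hosc0 : 0 ≤ osc (-(f - g)) := by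
      have x : X := Classical.arbitrary X
      simpa using sub_le_osc (-(f - g)) x x
    have h₂ := mul_le_mul he hosc hosc0 hε.le
    simp only [ContinuousMap.neg_apply, integral_neg] at h₁
    have h₃ := hsub P f g
    linarith
  · intro hC
    obtain ⟨m, hm, hmP⟩ := exists_mixture_integral_sub_le P h𝒬 h𝒬ne hε.le fun h hh => by
      have := hC h 0 fun Q hQ => by
        have hQh : 0 ≤ ∫ x, h x ∂(Q : Measure X) := hh ⟨Q, hQ⟩
        simpa using hQh
      simpa using this
    obtain ⟨Qm, hQm⟩ := exists_isBarycenter (m := m)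
    refine ⟨_, m, hm, Qm, hQm, tvNorm_sub_le_of_integral_sub_le hε.le fun f => ?_,
      (add_sub_cancel _ _).symm⟩
    rw [hQm.integral_eq (integrable_continuousMap f _)]
    exact hmP f

end
end
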